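/- arXiv:2310.04587 — 2 statements merged into one kernel-verified Lean document; each statement's English description precedes it below -/
import Mathlib

section
/- Every ω-cpo presentation admits a free ω-cpo: given an ω-cpo presentation (P, ≤, ◁), there exist an ω-cpo P_ω and a monotone, cover-preserving function η : P → P_ω such that for every ω-cpo X and every monotone, cover-preserving function f : P → X, there is a unique ω-continuous function f♯ : P_ω → X with f♯ ∘ η = f. -/
open OmegaCompletePartialOrder

universe u

/-- A function `f` from a preordered set `P` equipped with a cover relation `cov` into an
ω-cpo `X` *preserves covers* if whenever `p ◁ U`, the image `f '' U` is an ω-chain of `X`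
(i.e. the range of some monotone sequence `c : ℕ →o X`) and `f p` is below its supremum. -/
def PreservesCoversIntoωCPO {P : Type*} [Preorder P] (cov : P → Set P → Prop)
    {X : Type*} [OmegaCompletePartialOrder X] (f : P → X) : Prop :=
  ∀ p U, cov p U → ∃ c : Chain X, Set.range ⇑c = f '' U ∧ f p ≤ ωSup c

/-- The least lower set closed under the cover relation `cov` that contains `S`. -/
inductive CoverClosure {P : Type u} [Preorder P] (cov : P → Set P → Prop) (S : Set P) : Set P
  | of_mem {p : P} : p ∈ S → CoverClosure cov S p
  | of_le {p q : P} : p ≤ q → CoverClosure cov S q → CoverClosure cov S p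
  | of_cov {p : P} {U : Set P} : cov p U → (∀ q ∈ U, CoverClosure cov S q) → CoverClosure cov S p

namespace CoverClosure

variable {P : Type u} [Preorder P] {cov : P → Set P → Prop}

theorem subset_iff_of_closed {S T : Set P} (lower : IsLowerSet T)
    (closed : ∀ p U, cov p U → U ⊆ T → p ∈ T) : CoverClosure cov S ⊆ T ↔ S ⊆ T := by
  refine ⟨fun h p hp ↦ h (of_mem hp), fun h p hp ↦ ?_⟩
  induction hp with
  | of_mem hp => exact h hp
  | of_le hpq _ ih => exact lower hpq ih
  | of_cov hU _ ih => exact closed _ _ hU ih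

theorem subset_coverClosure_iff {S T : Set P} :
    CoverClosure cov S ⊆ CoverClosure cov T ↔ S ⊆ CoverClosure cov T :=
  subset_iff_of_closed (fun _ _ hpq hq ↦ of_le hpq hq) fun _ _ hU h ↦ of_cov hU h

/-- Along a monotone cover-preserving map, a set and its closure have the same upper bounds. -/
theorem upperBounds_image {X : Type*} [OmegaCompletePartialOrder X] {f : P → X}
    (hf : Monotone f) (hcf : PreservesCoversIntoωCPO cov f) (S : Set P) :
    upperBounds (f '' CoverClosure cov S) = upperBounds (f '' S) := by
  ext x
  have closed : ∀ p U, cov p U → U ⊆ f ⁻¹' Set.Iic x → p ∈ f ⁻¹' Set.Iic x := by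
    intro p U hU h
    obtain ⟨c, hc, hp⟩ := hcf p U hU
    refine hp.trans (ωSup_le _ _ fun n ↦ ?_)
    obtain ⟨q, hq, hqn⟩ : c n ∈ f '' U := hc ▸ Set.mem_range_self n
    exact hqn ▸ h hq
  simpa [mem_upperBounds, Set.subset_def] using
    subset_iff_of_closed (S := S) ((isLowerSet_Iic x).preimage hf) closed

end CoverClosure

/-- The sets generated from the closures of points by closures of unions of ω-chains. -/
inductive IsCoverGenerated {P : Type u} [Preorder P] (cov : P → Set P → Prop) : Set P → Prop
  | point (p : P) : IsCoverGenerated cov (CoverClosure cov {p})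
  | iUnion (c : ℕ → Set P) : Monotone c → (∀ n, IsCoverGenerated cov (c n)) →
      IsCoverGenerated cov (CoverClosure cov (⋃ n, c n))

theorem IsCoverGenerated.coverClosure_subset_iff {P : Type u} [Preorder P]
    {cov : P → Set P → Prop} {S I : Set P} (hI : IsCoverGenerated cov I) :
    CoverClosure cov S ⊆ I ↔ S ⊆ I := by
  cases hI <;> exact CoverClosure.subset_coverClosure_iff

/-- The free ω-cpo on the presentation `(P, cov)`, ordered by inclusion. -/
def FreeOmegaCpo {P : Type u} [Preorder P] (cov : P → Set P → Prop) : Type u :=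
  {I : Set P // IsCoverGenerated cov I}

namespace FreeOmegaCpo

variable {P : Type u} [Preorder P] {cov : P → Set P → Prop}

instance : PartialOrder (FreeOmegaCpo cov) :=
  inferInstanceAs (PartialOrder {I : Set P // IsCoverGenerated cov I})

instance : OmegaCompletePartialOrder (FreeOmegaCpo cov) where
  ωSup c := ⟨CoverClosure cov (⋃ n, (c n).1),
    .iUnion (fun n ↦ (c n).1) (fun _ _ h ↦ OrderHomClass.mono c h) fun n ↦ (c n).2⟩
  le_ωSup c n := show (c n).1 ⊆ CoverClosure cov _ from
    fun _ hp ↦ .of_mem (Set.mem_iUnion_of_mem n hp)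
  ωSup_le _ x h := x.2.coverClosure_subset_iff.2 (Set.iUnion_subset h)

/-- The closure of a point, as an element of the free ω-cpo. -/
def point (cov : P → Set P → Prop) (p : P) : FreeOmegaCpo cov :=
  ⟨CoverClosure cov {p}, .point p⟩

theorem point_le_iff {p : P} {x : FreeOmegaCpo cov} : point cov p ≤ x ↔ p ∈ x.1 :=
  x.2.coverClosure_subset_iff.trans Set.singleton_subset_iff

theorem monotone_point : Monotone (point cov) := fun _ _ h ↦
  point_le_iff.2 (.of_le h (.of_mem rfl))

theorem preservesCovers_point (hcov : ∀ p U, cov p U → ∃ c : ℕ →o P, U = Set.range ⇑c) :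
    PreservesCoversIntoωCPO cov (point cov) := by
  intro p U hU
  obtain ⟨c, rfl⟩ := hcov p U hU
  refine ⟨⟨⟨point cov ∘ c, monotone_point.comp c.monotone⟩⟩, Set.range_comp (point cov) c,
    point_le_iff.2 (.of_cov hU ?_)⟩
  rintro _ ⟨n, rfl⟩
  exact .of_mem (Set.mem_iUnion_of_mem n (.of_mem rfl))

@[elab_as_elim]
theorem induction {motive : FreeOmegaCpo cov → Prop} (point : ∀ p, motive (point cov p))
    (ωSup : ∀ c : Chain (FreeOmegaCpo cov), (∀ n, motive (c n)) → motive (ωSup c))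
    (x : FreeOmegaCpo cov) : motive x := by
  obtain ⟨I, hI⟩ := x
  induction hI with
  | point p => exact point p
  | iUnion c hc h ih => exact ωSup ⟨⟨fun n ↦ ⟨c n, h n⟩, hc⟩⟩ ih

section Lift

variable {X : Type*} [OmegaCompletePartialOrder X] {f : P → X}

theorem isLUB_image_point (hf : Monotone f) (hcf : PreservesCoversIntoωCPO cov f) (p : P) :
    IsLUB (f '' (point cov p).1) (f p) := by
  simp [IsLUB, point, CoverClosure.upperBounds_image hf hcf, isLeast_Ici]

theorem isLUB_image_ωSup (hf : Monotone f) (hcf : PreservesCoversIntoωCPO cov f)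
    (c : Chain (FreeOmegaCpo cov)) {x : ℕ → X} (hx : ∀ n, IsLUB (f '' (c n).1) (x n)) {y : X}
    (hy : IsLUB (Set.range x) y) : IsLUB (f '' (ωSup c).1) y := by
  have : upperBounds (f '' (ωSup c).1) = upperBounds (Set.range x) := by
    refine (CoverClosure.upperBounds_image hf hcf _).trans ?_
    ext z
    simp only [Set.image_iUnion, upperBounds_iUnion, Set.mem_iInter, ← isLUB_le_iff (hx _)]
    simp [mem_upperBounds]
  rwa [IsLUB, this]

theorem exists_isLUB_image (hf : Monotone f) (hcf : PreservesCoversIntoωCPO cov f)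
    (x : FreeOmegaCpo cov) : ∃ y, IsLUB (f '' x.1) y := by
  induction x using induction with
  | point p => exact ⟨f p, isLUB_image_point hf hcf p⟩
  | ωSup c ih =>
    choose x hx using ih
    have mono : Monotone x := fun m n h ↦
      (hx m).mono (hx n) (Set.image_mono (OrderHomClass.mono c h))
    exact ⟨_, isLUB_image_ωSup hf hcf c hx (isLUB_range_ωSup ⟨⟨x, mono⟩⟩)⟩

theorem exists_continuousHom (hf : Monotone f) (hcf : PreservesCoversIntoωCPO cov f) :
    ∃ g : FreeOmegaCpo cov →𝒄 X, ∀ p, g (point cov p) = f p := by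
  choose g hg using exists_isLUB_image hf hcf
  have mono : Monotone g := fun x y h ↦ (hg x).mono (hg y) (Set.image_mono h)
  refine ⟨⟨⟨g, mono⟩, fun c ↦ ?_⟩, fun p ↦ (hg _).unique (isLUB_image_point hf hcf p)⟩
  exact (hg _).unique (isLUB_image_ωSup hf hcf c (fun n ↦ hg (c n))
    (isLUB_range_ωSup (c.map ⟨g, mono⟩)))

theorem continuousHom_ext {g h : FreeOmegaCpo cov →𝒄 X}
    (H : ∀ p, g (point cov p) = h (point cov p)) : g = h := by
  ext x
  induction x using induction with
  | point p => exact H p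
  | ωSup c ih =>
    rw [g.ωScottContinuous.map_ωSup, h.ωScottContinuous.map_ωSup]
    congr 1
    ext n
    exact ih n

end Lift

end FreeOmegaCpo

/-- Every ω-cpo presentation `(P, ≤, ◁)` admits a free ω-cpo: there are an ω-cpo `Q` and a
monotone cover-preserving `η : P → Q` such that every monotone cover-preserving map `f` from
`P` to an ω-cpo `X` extends uniquely along `η` to an ω-continuous map `Q →𝒄 X`. -/
theorem free_omegaCpo_on_presentation
    (P : Type u) [Preorder P] (cov : P → Set P → Prop)
    (hcov : ∀ p U, cov p U → ∃ c : ℕ →o P, U = Set.range ⇑c) :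
    ∃ (Q : Type u) (_ : OmegaCompletePartialOrder Q) (η : P → Q),
      Monotone η ∧ PreservesCoversIntoωCPO cov η ∧
      ∀ (X : Type u) (_ : OmegaCompletePartialOrder X) (f : P → X),
        Monotone f → PreservesCoversIntoωCPO cov f →
          ∃! g : Q →𝒄 X, ∀ p : P, g (η p) = f p := by
  refine ⟨FreeOmegaCpo cov, inferInstance, FreeOmegaCpo.point cov, FreeOmegaCpo.monotone_point,
    FreeOmegaCpo.preservesCovers_point hcov, fun X _ f hf hcf ↦ ?_⟩
  obtain ⟨g, hg⟩ := FreeOmegaCpo.exists_continuousHom hf hcf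
  exact ⟨g, hg, fun h hh ↦ FreeOmegaCpo.continuousHom_ext fun p ↦ (hh p).trans (hg p).symm⟩
end

section
/- For any set X, there is a bijection between: (i) admissible sets of simplices on X, i.e., sets 𝒮 of nonempty finite subsets of X that contain every singleton {x} (x ∈ X) and are downward closed under nonempty subsets (if s′ ⊆ s, s′ ≠ ∅, and s ∈ 𝒮 then s′ ∈ 𝒮); and (ii) families (R_n)_{n ≥ 1} of relations R_n ⊆ X^n that are reflexive (for all n ≥ 1 and x ∈ X, (x, …, x) ∈ R_n) and closed under reindexing (for all n, m ≥ 1, every function h : {1, …, n} → {1, …, m}, and every (x_1, …, x_m) ∈ R_m, also (x_{h(1)}, …, x_{h(n)}) ∈ R_n). The bijection sends a family (R_n) to 𝒮 = { {x_1, …, x_n} : n ≥ 1, (x_1, …, x_n) ∈ R_n }, and conversely sends 𝒮 to the family given by (x_1, …, x_n) ∈ R_n iff {x_1, …, x_n} ∈ 𝒮; these two constructions are mutually inverse. -/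
universe u

/-- An admissible set of simplices on a set `X`: a set of nonempty finite subsets of `X`
containing every singleton and downward closed under nonempty subsets. This is the data of
an (abstract) simplicial complex on `X`. -/
def AdmissibleSimplices (X : Type u) : Type u :=
  { 𝒮 : Set (Finset X) //
      (∀ s ∈ 𝒮, s.Nonempty) ∧
      (∀ x : X, ({x} : Finset X) ∈ 𝒮) ∧
      (∀ s ∈ 𝒮, ∀ s' : Finset X, s' ⊆ s → s'.Nonempty → s' ∈ 𝒮) }

/-- A family of relations `R n ⊆ X^(n+1)` (one `(n+1)`-ary relation for each `n`, so one
`n`-ary relation for each `n ≥ 1`) that is reflexive and closed under reindexing along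
arbitrary functions. This is the data of a model of the relational Horn theory `𝕋_Simp`
on the underlying set `X`. -/
def SimpRelFamilies (X : Type u) : Type u :=
  { R : (n : ℕ) → (Fin (n + 1) → X) → Prop //
      (∀ (n : ℕ) (x : X), R n fun _ => x) ∧
      (∀ (n m : ℕ) (h : Fin (n + 1) → Fin (m + 1)) (v : Fin (m + 1) → X),
        R m v → R n (v ∘ h)) }

/-- The finite subset `{v 0, …, v n}` of `X` given by the entries of a tuple
`v : Fin (n+1) → X`. -/
noncomputable def tupleSet {X : Type u} {n : ℕ} (v : Fin (n + 1) → X) : Finset X :=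
  @Finset.image _ _ (Classical.decEq X) v Finset.univ

theorem mem_tupleSet {X : Type u} {n : ℕ} {v : Fin (n + 1) → X} {x : X} :
    x ∈ tupleSet v ↔ ∃ i, v i = x := by
  simp [tupleSet]

theorem tupleSet_nonempty {X : Type u} {n : ℕ} (v : Fin (n + 1) → X) :
    (tupleSet v).Nonempty :=
  ⟨v 0, mem_tupleSet.2 ⟨0, rfl⟩⟩

theorem tupleSet_const {X : Type u} (n : ℕ) (x : X) :
    tupleSet (fun _ : Fin (n + 1) => x) = {x} := by
  ext y
  simp [mem_tupleSet, eq_comm]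

theorem tupleSet_comp_subset {X : Type u} {n m : ℕ} (v : Fin (m + 1) → X)
    (h : Fin (n + 1) → Fin (m + 1)) : tupleSet (v ∘ h) ⊆ tupleSet v := by
  intro x hx
  obtain ⟨i, rfl⟩ := mem_tupleSet.1 hx
  exact mem_tupleSet.2 ⟨h i, rfl⟩

/-- Every nonempty finite set is the set of entries of a tuple. -/
theorem exists_tupleSet_eq {X : Type u} {s : Finset X} (hs : s.Nonempty) :
    ∃ (n : ℕ) (v : Fin (n + 1) → X), tupleSet v = s := by
  obtain ⟨n, hn⟩ := Nat.exists_eq_succ_of_ne_zero hs.card_pos.ne'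
  let e := s.equivFinOfCardEq hn
  refine ⟨n, fun i => (e.symm i : X), ?_⟩
  ext x
  rw [mem_tupleSet]
  constructor
  · rintro ⟨i, rfl⟩
    exact (e.symm i).2
  · intro hx
    exact ⟨e ⟨x, hx⟩, by simp⟩

/-- A reindexing-closed family holds of any tuple whose entries occur in a tuple of which it
holds. -/
theorem SimpRelFamilies.of_tupleSet_subset {X : Type u} (R : SimpRelFamilies X) {n m : ℕ}
    {v : Fin (m + 1) → X} {w : Fin (n + 1) → X} (hv : R.1 m v)
    (hwv : tupleSet w ⊆ tupleSet v) : R.1 n w := by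
  have key : ∀ i, ∃ j, v j = w i := fun i =>
    mem_tupleSet.1 (hwv (mem_tupleSet.2 ⟨i, rfl⟩))
  choose h hh using key
  have hvw : v ∘ h = w := funext hh
  exact hvw ▸ R.2.2 n m h v hv

/-- The admissible set of simplices formed by the entries of the tuples in a family. -/
def SimpRelFamilies.toAdmissibleSimplices {X : Type u} (R : SimpRelFamilies X) :
    AdmissibleSimplices X :=
  ⟨{ s : Finset X | ∃ (n : ℕ) (v : Fin (n + 1) → X), R.1 n v ∧ s = tupleSet v }, by
    refine ⟨?_, fun x => ⟨0, fun _ => x, R.2.1 0 x, (tupleSet_const 0 x).symm⟩, ?_⟩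
    · rintro _ ⟨n, v, -, rfl⟩
      exact tupleSet_nonempty v
    · rintro _ ⟨m, v, hv, rfl⟩ s' hs' hne
      obtain ⟨n, w, rfl⟩ := exists_tupleSet_eq hne
      exact ⟨n, w, R.of_tupleSet_subset hv hs', rfl⟩⟩

/-- The family of relations holding of the tuples whose entries form a simplex. -/
def AdmissibleSimplices.toSimpRelFamilies {X : Type u} (𝒮 : AdmissibleSimplices X) :
    SimpRelFamilies X :=
  ⟨fun _ v => tupleSet v ∈ 𝒮.1,
    fun n x => Set.mem_of_eq_of_mem (tupleSet_const n x) (𝒮.2.2.1 x),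
    fun _ _ h v hv => 𝒮.2.2.2 _ hv _ (tupleSet_comp_subset v h) (tupleSet_nonempty _)⟩

/-- Families of relations and admissible sets of simplices on `X` determine each other. -/
def simpRelFamiliesEquiv (X : Type u) : SimpRelFamilies X ≃ AdmissibleSimplices X where
  toFun := SimpRelFamilies.toAdmissibleSimplices
  invFun := AdmissibleSimplices.toSimpRelFamilies
  left_inv R := by
    refine Subtype.ext (funext fun n => funext fun w => propext ⟨?_, fun hw => ⟨n, w, hw, rfl⟩⟩)
    rintro ⟨m, v, hv, hwv⟩
    exact R.of_tupleSet_subset hv hwv.subset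
  right_inv 𝒮 := by
    refine Subtype.ext (Set.ext fun s => ⟨?_, fun hs => ?_⟩)
    · rintro ⟨n, v, hv, rfl⟩
      exact hv
    · obtain ⟨n, v, rfl⟩ := exists_tupleSet_eq (𝒮.2.1 s hs)
      exact ⟨n, v, hs, rfl⟩

/-- For any set `X`, there is a bijection between reflexive, reindexing-closed families of
relations `(R_n)_{n ≥ 1}` on `X` and admissible sets of simplices on `X`, sending a family
`R` to `{ {x_1, …, x_n} | (x_1, …, x_n) ∈ R_n }` and, inversely, an admissible set `𝒮` to
the family given by `(x_1, …, x_n) ∈ R_n ↔ {x_1, …, x_n} ∈ 𝒮`; these two constructions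
are mutually inverse. -/
theorem simpRelFamilies_equiv_admissibleSimplices (X : Type u) :
    ∃ e : SimpRelFamilies X ≃ AdmissibleSimplices X,
      (∀ R : SimpRelFamilies X,
        (e R).1 = { s : Finset X |
          ∃ (n : ℕ) (v : Fin (n + 1) → X), R.1 n v ∧ s = tupleSet v }) ∧
      (∀ (𝒮 : AdmissibleSimplices X) (n : ℕ) (v : Fin (n + 1) → X),
        (e.symm 𝒮).1 n v ↔ tupleSet v ∈ 𝒮.1) := by
  exact ⟨simpRelFamiliesEquiv X, fun _ => rfl, fun _ _ _ => Iff.rfl⟩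
end
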